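/- (Representation Formula) Let n ≥ 1, let Ω ⊆ 𝕆_sⁿ be an axially symmetric slice-domain, and let f : Ω → 𝕆 be weak slice regular. Then for all x, y ∈ ℝⁿ and all I, J ∈ 𝕊 such that x+yI, x+yJ and x−yJ all lie in Ω, f(x+yI) = (1/2)·(f(x+yJ) + f(x−yJ)) − (1/2)·I·(J·(f(x+yJ) − f(x−yJ))), where the products are octonion products with the parenthesization written. -/

import Mathlib

/-! Octonions via the Cayley–Dickson construction on the quaternions,
the n-dimensional quadratic cone, the slice topology, and slice regularity. -/

noncomputable section
open Quaternion Topology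

/-- The octonions, as `ℍ × ℍ` with the (L²) Euclidean norm and
Cayley–Dickson multiplication. -/
abbrev Oct : Type := WithLp 2 (ℍ × ℍ)

namespace Oct

def c1 (p : Oct) : ℍ := (WithLp.equiv 2 (ℍ × ℍ) p).1
def c2 (p : Oct) : ℍ := (WithLp.equiv 2 (ℍ × ℍ) p).2
def mk (a b : ℍ) : Oct := (WithLp.equiv 2 (ℍ × ℍ)).symm (a, b)

instance : One Oct := ⟨mk 1 0⟩

/-- Cayley–Dickson multiplication. -/
instance : Mul Oct :=
  ⟨fun p q => mk (c1 p * c1 q - star (c2 q) * c2 p) (c2 q * c1 p + c2 p * star (c1 q))⟩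

/-- Octonionic conjugation. -/
instance : Star Oct := ⟨fun p => mk (star (c1 p)) (-(c2 p))⟩

/-- Inverse: `p⁻¹ = ‖p‖⁻² • (star p)` (so `0⁻¹ = 0`). -/
instance : Inv Oct := ⟨fun p => (‖p‖ ^ 2)⁻¹ • star p⟩

/-- The real inner product on `𝕆 ≅ ℝ⁸`, via polarization. -/
def oinner (p q : Oct) : ℝ := (1 / 4) * (‖p + q‖ ^ 2 - ‖p - q‖ ^ 2)

/-- The sphere `𝕊` of imaginary units of the octonions. -/
def Sph : Set Oct := {I | I * I = -1}

/-- The slice complex plane `ℂ_I = ℝ + ℝ I ⊆ 𝕆`. -/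
def CI (I : Oct) : Set Oct := {z | ∃ s t : ℝ, z = s • (1 : Oct) + t • I}

end Oct

open Oct

/-- The point `x + y I ∈ ℂ_Iⁿ ⊆ 𝕆ⁿ`. -/
def aff {n : ℕ} (x y : Fin n → ℝ) (I : Oct) : Fin n → Oct :=
  fun m => x m • (1 : Oct) + y m • I

/-- The embedding `ℝⁿ ⊆ 𝕆ⁿ`. -/
def ofRealn {n : ℕ} (x : Fin n → ℝ) : Fin n → Oct := fun m => x m • (1 : Oct)

/-- The slice `ℂ_Iⁿ ⊆ 𝕆ⁿ`. -/
def slicen (n : ℕ) (I : Oct) : Set (Fin n → Oct) := {q | ∃ x y : Fin n → ℝ, q = aff x y I}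

/-- The `n`-dimensional quadratic cone `𝕆ₛⁿ = ⋃_{I ∈ 𝕊} ℂ_Iⁿ`. -/
def cone (n : ℕ) : Set (Fin n → Oct) := ⋃ I ∈ Sph, slicen n I

/-- The slice topology `τ_s`: a set is open iff its trace on every slice `ℂ_Iⁿ`
is open (expressed via the canonical parametrizations `(x,y) ↦ x + yI`). -/
def τs (n : ℕ) : TopologicalSpace (Fin n → Oct) :=
  ⨆ I : Sph, TopologicalSpace.coinduced
    (fun p : (Fin n → ℝ) × (Fin n → ℝ) => aff p.1 p.2 I.1) inferInstance

/-- A slice-open subset of the quadratic cone. -/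
def SliceOpen (n : ℕ) (Ω : Set (Fin n → Oct)) : Prop :=
  Ω ⊆ cone n ∧ IsOpen[τs n] Ω

/-- A slice-domain: a nonempty slice-connected slice-open subset of the cone. -/
def SliceDomain (n : ℕ) (Ω : Set (Fin n → Oct)) : Prop :=
  SliceOpen n Ω ∧ @IsConnected _ (τs n) Ω

/-- Real-connectedness: `Ω ∩ ℝⁿ` is a (pre)connected subset of `ℝⁿ`. -/
def RealConnected (n : ℕ) (Ω : Set (Fin n → Oct)) : Prop :=
  IsPreconnected {x : Fin n → ℝ | ofRealn x ∈ Ω}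

/-- Axially symmetric subsets of the cone. -/
def AxSymm (n : ℕ) (Ω : Set (Fin n → Oct)) : Prop :=
  ∀ (x y : Fin n → ℝ), ∀ I ∈ Sph, ∀ J ∈ Sph, aff x y I ∈ Ω → aff x y J ∈ Ω

/-- The upper half-space `ℝ²ⁿ₊`: pairs `(x,y)` with `y = 0` or the first
nonzero coordinate of `y` positive. -/
def pos2n (n : ℕ) : Set ((Fin n → ℝ) × (Fin n → ℝ)) :=
  {p | p.2 = 0 ∨ ∃ m : Fin n, 0 < p.2 m ∧ ∀ k : Fin n, k < m → p.2 k = 0}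

/-- `Ω_{s₁}`. -/
def s1 {n : ℕ} (Ω : Set (Fin n → Oct)) : Set ((Fin n → ℝ) × (Fin n → ℝ)) :=
  {p | ∃ I ∈ Sph, aff p.1 p.2 I ∈ Ω}

/-- `Ω_{s₂}`. -/
def s2 {n : ℕ} (Ω : Set (Fin n → Oct)) : Set ((Fin n → ℝ) × (Fin n → ℝ)) :=
  {p | ∃ J ∈ Sph, ∃ K ∈ Sph, J ≠ K ∧ aff p.1 p.2 J ∈ Ω ∧ aff p.1 p.2 K ∈ Ω}

/-- Slice functions: induced on `Ω_{s₂}⁺` by a pair `(F₁, F₂)` via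
`f(x + yI) = F₁(x,y) + I·F₂(x,y)`. -/
def IsSliceFun (n : ℕ) (Ω : Set (Fin n → Oct)) (f : (Fin n → Oct) → Oct) : Prop :=
  ∃ F₁ F₂ : (Fin n → ℝ) × (Fin n → ℝ) → Oct,
    ∀ x y : Fin n → ℝ, (x, y) ∈ s2 Ω ∩ pos2n n → ∀ I ∈ Sph, aff x y I ∈ Ω →
      f (aff x y I) = F₁ (x, y) + I * F₂ (x, y)

/-- Holomorphy of a function of `n` slice variables, read through the
parametrization `(x,y) ↦ x + yI`: continuous partial derivatives (i.e. `C¹`)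
and the Cauchy–Riemann equations `(∂/∂xₘ + I ∂/∂yₘ) g = 0` on `U`. -/
def Holo (n : ℕ) (I : Oct) (g : (Fin n → ℝ) × (Fin n → ℝ) → Oct)
    (U : Set ((Fin n → ℝ) × (Fin n → ℝ))) : Prop :=
  ContDiffOn ℝ 1 g U ∧
  ∀ p ∈ U, ∀ m : Fin n,
    fderiv ℝ g p (Pi.single m 1, 0) + I * fderiv ℝ g p (0, Pi.single m 1) = 0

/-- Weak slice regularity: each restriction `f|_{Ω ∩ ℂ_Iⁿ}` is holomorphic. -/
def WSliceReg (n : ℕ) (Ω : Set (Fin n → Oct)) (f : (Fin n → Oct) → Oct) : Prop :=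
  ∀ I ∈ Sph, Holo n I (fun p => f (aff p.1 p.2 I)) {p | aff p.1 p.2 I ∈ Ω}

/-- The complex structure `σ(a,b) = (−b,a)` on `𝕆²`. -/
def sigma2 : Oct × Oct → Oct × Oct := fun w => (-w.2, w.1)

/-- Holomorphic stem maps: `F : V → 𝕆²` extends to a `C¹` map `G` on an open
neighborhood `U ⊇ V` satisfying `(∂/∂xₘ + σ ∂/∂yₘ) G = 0` on `U`. -/
def StemHolo (n : ℕ) (V : Set ((Fin n → ℝ) × (Fin n → ℝ)))
    (F : (Fin n → ℝ) × (Fin n → ℝ) → Oct × Oct) : Prop :=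
  ∃ (U : Set ((Fin n → ℝ) × (Fin n → ℝ))) (G : (Fin n → ℝ) × (Fin n → ℝ) → Oct × Oct),
    IsOpen U ∧ V ⊆ U ∧ Set.EqOn G F V ∧ ContDiffOn ℝ 1 G U ∧
    ∀ p ∈ U, ∀ m : Fin n,
      fderiv ℝ G p (Pi.single m 1, 0) + sigma2 (fderiv ℝ G p (0, Pi.single m 1)) = 0

/-- Strong slice regularity: `f` is induced by a holomorphic stem map on `Ω_{s₁}`. -/
def SSliceReg (n : ℕ) (Ω : Set (Fin n → Oct)) (f : (Fin n → Oct) → Oct) : Prop :=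
  ∃ F : (Fin n → ℝ) × (Fin n → ℝ) → Oct × Oct, StemHolo n (s1 Ω) F ∧
    ∀ x y : Fin n → ℝ, ∀ I ∈ Sph, aff x y I ∈ Ω →
      f (aff x y I) = (F (x, y)).1 + I * (F (x, y)).2

/-- An s-basis `{I, J, K}` of the octonions. -/
def IsSBasis (I J K : Oct) : Prop :=
  I ∈ Sph ∧ J ∈ Sph ∧ K ∈ Sph ∧
  LinearIndependent ℝ ![(1 : Oct), I, J, I * J, K, J * K, I * K, (I * J) * K] ∧
  Submodule.span ℝ (Set.range ![(1 : Oct), I, J, I * J, K, J * K, I * K, (I * J) * K]) = ⊤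

/-- Iterated left multiplication `L_w^β = (L_{w₁})^{β₁} ∘ ⋯ ∘ (L_{wₙ})^{βₙ}`. -/
def Lpow {n : ℕ} (w : Fin n → Oct) (β : Fin n → ℕ) : Oct → Oct :=
  fun a => (List.finRange n).foldr (fun ℓ c => (fun o => w ℓ * o)^[β ℓ] c) a

/-- The `*`-power `(q − p)^{*α} a = ∑_{β ≤ α} C(α,β) L_q^β (L_{−p}^{α−β} a)`. -/
def starPow {n : ℕ} (p : Fin n → Oct) (α : Fin n → ℕ) (a : Oct) (q : Fin n → Oct) : Oct :=
  ∑ β ∈ Finset.Iic α, (∏ ℓ, (α ℓ).choose (β ℓ)) • Lpow q β (Lpow (-p) (α - β) a)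

/-- The `ℓ`-th slice derivative `∂_ℓ f (x + w) = (∂/∂x_ℓ) f (x + w)`. -/
def sderiv {n : ℕ} (ℓ : Fin n) (f : (Fin n → Oct) → Oct) : (Fin n → Oct) → Oct :=
  fun q => deriv (fun t : ℝ => f (fun m => q m + (if m = ℓ then t else 0) • (1 : Oct))) 0

/-- The iterated slice derivative `f^{(α)} = (∂₁)^{α₁} ⋯ (∂ₙ)^{αₙ} f`. -/
def sderivMulti {n : ℕ} (α : Fin n → ℕ) (f : (Fin n → Oct) → Oct) : (Fin n → Oct) → Oct :=
  (List.finRange n).foldr (fun ℓ g => (sderiv ℓ)^[α ℓ] g) f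

/-- The slice-polydisc `P̃(q₀, r)` (relative to `I ∈ 𝕊` with `q₀ ∈ ℂ_Iⁿ`):
points `x + yJ` with `x ± yI` in the closed polydisc `P_I(q₀, r)`. -/
def polyDisc {n : ℕ} (q₀ : Fin n → Oct) (I : Oct) (r : Fin n → ℝ) : Set (Fin n → Oct) :=
  {q | ∃ x y : Fin n → ℝ, ∃ J ∈ Sph, q = aff x y J ∧
        (∀ ℓ, ‖aff x y I ℓ - q₀ ℓ‖ ≤ r ℓ) ∧ (∀ ℓ, ‖aff x (-y) I ℓ - q₀ ℓ‖ ≤ r ℓ)}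

namespace Oct

theorem ext_parts {p q : Oct} (h₁ : c1 p = c1 q) (h₂ : c2 p = c2 q) : p = q :=
  (WithLp.equiv 2 (ℍ × ℍ)).injective (Prod.ext h₁ h₂)

theorem c1_mul (p q : Oct) : c1 (p * q) = c1 p * c1 q - star (c2 q) * c2 p := rfl
theorem c2_mul (p q : Oct) : c2 (p * q) = c2 q * c1 p + c2 p * star (c1 q) := rfl
theorem c1_one : c1 1 = 1 := rfl
theorem c2_one : c2 1 = 0 := rfl
theorem c1_add (p q : Oct) : c1 (p + q) = c1 p + c1 q := rfl
theorem c2_add (p q : Oct) : c2 (p + q) = c2 p + c2 q := rfl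
theorem c1_neg (p : Oct) : c1 (-p) = -c1 p := rfl
theorem c2_neg (p : Oct) : c2 (-p) = -c2 p := rfl
theorem c1_smul (r : ℝ) (p : Oct) : c1 (r • p) = r • c1 p := rfl
theorem c2_smul (r : ℝ) (p : Oct) : c2 (r • p) = r • c2 p := rfl

/-- Left multiplication by an octonion, as a continuous real-linear map. -/
def mulLeftL (a : Oct) : Oct →L[ℝ] Oct :=
  LinearMap.toContinuousLinearMap
    { toFun := fun q => a * q
      map_add' := fun p q => by
        apply ext_parts
        · simp only [c1_mul, c1_add, c2_add, star_add, mul_add, add_mul]; abel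
        · simp only [c2_mul, c1_add, c2_add, star_add, mul_add, add_mul]; abel
      map_smul' := fun r q => by
        apply ext_parts
        · simp [c1_mul, c1_smul, c2_smul, smul_sub]
        · simp [c2_mul, c1_smul, c2_smul, smul_add] }

theorem mulLeftL_apply (a q : Oct) : mulLeftL a q = a * q := rfl

theorem mul_add' (a p q : Oct) : a * (p + q) = a * p + a * q := (mulLeftL a).map_add p q
theorem mul_neg' (a p : Oct) : a * (-p) = -(a * p) := (mulLeftL a).map_neg p
theorem mul_sub' (a p q : Oct) : a * (p - q) = a * p - a * q := (mulLeftL a).map_sub p q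
theorem mul_smul' (a : Oct) (r : ℝ) (q : Oct) : a * (r • q) = r • (a * q) :=
  (mulLeftL a).map_smul r q

theorem neg_mul' (a q : Oct) : -a * q = -(a * q) := by
  apply ext_parts
  · simp only [c1_mul, c1_neg, c2_neg, neg_mul, mul_neg]; abel
  · simp only [c2_mul, c1_neg, c2_neg, neg_mul, mul_neg]; abel

theorem norm_sq_eq (p : Oct) :
    ‖p‖ ^ 2 = (c1 p).re ^ 2 + (c1 p).imI ^ 2 + (c1 p).imJ ^ 2 + (c1 p).imK ^ 2 +
      ((c2 p).re ^ 2 + (c2 p).imI ^ 2 + (c2 p).imJ ^ 2 + (c2 p).imK ^ 2) := by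
  rw [WithLp.prod_norm_sq_eq_of_L2, sq ‖p.fst‖, sq ‖p.snd‖, ← Quaternion.normSq_eq_norm_mul_self,
    ← Quaternion.normSq_eq_norm_mul_self, Quaternion.normSq_def', Quaternion.normSq_def']
  rfl

theorem neg_mem_Sph {I : Oct} (hI : I ∈ Sph) : -I ∈ Sph := by
  change -I * -I = -1
  rw [neg_mul', mul_neg', neg_neg]
  exact hI

theorem re_eq_zero_of_mem_Sph {I : Oct} (hI : I ∈ Sph) : (c1 I).re = 0 := by
  have h₁ : c1 (I * I) = c1 (-1) := congrArg c1 hI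
  have h₂ : c2 (I * I) = c2 (-1) := congrArg c2 hI
  rw [c1_mul, c1_neg, c1_one, Quaternion.ext_iff] at h₁
  rw [c2_mul, c2_neg, c2_one, Quaternion.ext_iff] at h₂
  simp at h₁ h₂
  obtain ⟨a1, a2, a3, a4⟩ := h₁
  obtain ⟨b1, b2, b3, b4⟩ := h₂
  by_contra h
  have k1 : (c1 I).imI = 0 := by apply mul_left_cancel₀ h; linarith
  have k2 : (c1 I).imJ = 0 := by apply mul_left_cancel₀ h; linarith
  have k3 : (c1 I).imK = 0 := by apply mul_left_cancel₀ h; linarith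
  simp only [k1, k2, k3] at *
  have l1 : (c2 I).re = 0 := b1.resolve_right h
  have l2 : (c2 I).imI = 0 := by apply mul_left_cancel₀ h; linarith
  have l3 : (c2 I).imJ = 0 := by apply mul_left_cancel₀ h; linarith
  have l4 : (c2 I).imK = 0 := by apply mul_left_cancel₀ h; linarith
  simp only [l1, l2, l3, l4] at *
  nlinarith [mul_self_nonneg (c1 I).re]

theorem norm_sq_of_mem_Sph {I : Oct} (hI : I ∈ Sph) : ‖I‖ ^ 2 = 1 := by
  have h₁ : c1 (I * I) = c1 (-1) := congrArg c1 hI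
  rw [c1_mul, c1_neg, c1_one, Quaternion.ext_iff] at h₁
  have h0 := re_eq_zero_of_mem_Sph hI
  simp [h0] at h₁
  rw [norm_sq_eq, h0]
  linarith [h₁.1]

theorem norm_smul_add_smul_mul {I : Oct} (hI : I ∈ Sph) (s t : ℝ) (q : Oct) :
    ‖s • q + t • (I * q)‖ ^ 2 = (s ^ 2 + t ^ 2) * ‖q‖ ^ 2 := by
  have hN := norm_sq_of_mem_Sph hI
  rw [norm_sq_eq] at hN
  have h0 := re_eq_zero_of_mem_Sph hI
  rw [norm_sq_eq, norm_sq_eq q]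
  simp only [c1_add, c2_add, c1_smul, c2_smul, c1_mul, c2_mul]
  simp [h0] at hN ⊢
  linear_combination (t ^ 2 * ((c1 q).re ^ 2 + (c1 q).imI ^ 2 + (c1 q).imJ ^ 2 + (c1 q).imK ^ 2 +
      ((c2 q).re ^ 2 + (c2 q).imI ^ 2 + (c2 q).imJ ^ 2 + (c2 q).imK ^ 2))) * hN

theorem mul_mul_self_of_mem_Sph {I : Oct} (hI : I ∈ Sph) (q : Oct) : I * (I * q) = -q := by
  have hN := norm_sq_of_mem_Sph hI
  rw [norm_sq_eq] at hN
  have h0 := re_eq_zero_of_mem_Sph hI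
  simp only [h0] at hN
  apply ext_parts <;> apply Quaternion.ext <;>
    simp only [c1_mul, c2_mul, c1_neg, c2_neg] <;> simp [h0]
  · linear_combination (-(c1 q).re) * hN
  · linear_combination (-(c1 q).imI) * hN
  · linear_combination (-(c1 q).imJ) * hN
  · linear_combination (-(c1 q).imK) * hN
  · linear_combination (-(c2 q).re) * hN
  · linear_combination (-(c2 q).imI) * hN
  · linear_combination (-(c2 q).imJ) * hN
  · linear_combination (-(c2 q).imK) * hN

/-- The complex structure on the octonions given by left multiplication by `I ∈ 𝕊`. -/
@[reducible]
def complexModule {I : Oct} (hI : I ∈ Sph) : Module ℂ Oct where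
  smul z q := z.re • q + z.im • (I * q)
  one_smul q := by
    change (1 : ℂ).re • q + (1 : ℂ).im • (I * q) = q
    simp
  mul_smul z w q := by
    change (z * w).re • q + (z * w).im • (I * q) = z.re • (w.re • q + w.im • (I * q)) +
      z.im • (I * (w.re • q + w.im • (I * q)))
    rw [mul_add', mul_smul', mul_smul', mul_mul_self_of_mem_Sph hI, Complex.mul_re, Complex.mul_im]
    module
  smul_zero z := by
    change z.re • (0 : Oct) + z.im • (I * (0 : Oct)) = 0
    rw [← mulLeftL_apply]; simp
  smul_add z p q := by
    change z.re • (p + q) + z.im • (I * (p + q)) =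
      z.re • p + z.im • (I * p) + (z.re • q + z.im • (I * q))
    rw [mul_add']; module
  add_smul z w q := by
    change (z + w).re • q + (z + w).im • (I * q) =
      z.re • q + z.im • (I * q) + (w.re • q + w.im • (I * q))
    rw [Complex.add_re, Complex.add_im]; module
  zero_smul q := by
    change (0 : ℂ).re • q + (0 : ℂ).im • (I * q) = 0
    simp

/-- The octonions as a complex normed space through left multiplication by `I ∈ 𝕊`. -/
@[reducible]
def complexNormedSpace {I : Oct} (hI : I ∈ Sph) : NormedSpace ℂ Oct :=
  { complexModule hI with
    norm_smul_le := fun z q => by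
      change ‖z.re • q + z.im • (I * q)‖ ≤ ‖z‖ * ‖q‖
      refine le_of_eq ((sq_eq_sq₀ (norm_nonneg _) (by positivity)).1 ?_)
      rw [norm_smul_add_smul_mul hI, mul_pow, Complex.sq_norm, Complex.normSq_apply]
      ring }

theorem isScalarTower_complex {I : Oct} (hI : I ∈ Sph) :
    letI := complexNormedSpace hI
    IsScalarTower ℝ ℂ Oct :=
  letI := complexNormedSpace hI
  ⟨fun r z q => by
    change (r • z).re • q + (r • z).im • (I * q) = r • (z.re • q + z.im • (I * q))
    simp [mul_smul]⟩

theorem smul_one_add_smul_eq {K K' : Oct} (hK : K ∈ Sph) (hK' : K' ∈ Sph) {s t s' t' : ℝ}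
    (h : s • (1 : Oct) + t • K = s' • (1 : Oct) + t' • K') :
    s = s' ∧ t • K = t' • K' ∧ t ^ 2 = t' ^ 2 := by
  have hs : s = s' := by
    have := congrArg (fun q => (c1 q).re) h
    simpa [c1_add, c1_smul, c1_one, re_eq_zero_of_mem_Sph hK, re_eq_zero_of_mem_Sph hK'] using this
  subst hs
  have ht := add_left_cancel h
  refine ⟨rfl, ht, ?_⟩
  have := congrArg (fun q => ‖q‖ ^ 2) ht
  simpa [norm_smul, mul_pow, norm_sq_of_mem_Sph hK, norm_sq_of_mem_Sph hK'] using this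

theorem mk_zero_mem_Sph {b : ℍ} (hb : star b * b = 1) : mk 0 b ∈ Sph := by
  apply ext_parts
  · change (0 : ℍ) * 0 - star b * b = -1
    simp [hb]
  · change b * (0 : ℍ) + b * star (0 : ℍ) = -0
    simp

theorem exists_mem_Sph_ne (I : Oct) : ∃ K ∈ Sph, K ≠ I ∧ K ≠ -I := by
  have h1 : mk 0 1 ∈ Sph := mk_zero_mem_Sph (by simp)
  obtain ⟨i, hi1, hi2, hi3, hi4⟩ : ∃ i : ℍ, i.re = 0 ∧ i.imI = 1 ∧ i.imJ = 0 ∧ i.imK = 0 :=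
    ⟨⟨0, 1, 0, 0⟩, rfl, rfl, rfl, rfl⟩
  have h2 : mk 0 i ∈ Sph := mk_zero_mem_Sph (by
    rw [Quaternion.star_mul_self, Quaternion.normSq_def', hi1, hi2, hi3, hi4]; simp)
  have hre (b : ℍ) (q : Oct) (h : mk 0 b = q) : c2 q = b := by rw [← h]; rfl
  by_contra! hcon
  have d1 : c2 I = 1 ∨ -c2 I = 1 := by
    by_cases h : mk 0 1 = I
    · exact Or.inl (hre _ _ h)
    · exact Or.inr (hre _ _ (hcon _ h1 h))
  have d2 : c2 I = i ∨ -c2 I = i := by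
    by_cases h : mk 0 i = I
    · exact Or.inl (hre _ _ h)
    · exact Or.inr (hre _ _ (hcon _ h2 h))
  have e1 : (c2 I).imI = 0 := by
    rcases d1 with h | h <;> simpa using congrArg (fun q : ℍ => q.imI) h
  rcases d2 with h | h <;> simpa [e1, hi2] using congrArg (fun q : ℍ => q.imI) h

end Oct

section Slices

variable {n : ℕ}

theorem aff_neg (x y : Fin n → ℝ) (I : Oct) : aff x (-y) I = aff x y (-I) := by
  funext m; simp [aff]

theorem aff_zero (x : Fin n → ℝ) (I J : Oct) : aff x 0 I = aff x 0 J := by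
  funext m; simp [aff]

theorem aff_eq_aff {x y x' y' : Fin n → ℝ} {K K' : Oct} (hK : K ∈ Sph) (hK' : K' ∈ Sph)
    (h : aff x y K = aff x' y' K') :
    x = x' ∧ (y = 0 ∧ y' = 0 ∨ y = y' ∧ K = K' ∨ y = -y' ∧ K = -K') := by
  have hm (m : Fin n) := smul_one_add_smul_eq hK hK' (congrFun h m)
  refine ⟨funext fun m => (hm m).1, ?_⟩
  have K0 (L : Oct) (hL : L ∈ Sph) : L ≠ 0 := by
    rintro rfl
    simpa using norm_sq_of_mem_Sph hL
  by_cases hy : y = 0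
  · refine Or.inl ⟨hy, funext fun m => ?_⟩
    simpa [hy, eq_comm] using (hm m).2.2
  obtain ⟨m, hym⟩ := Function.ne_iff.1 hy
  simp only [Pi.zero_apply] at hym
  rcases sq_eq_sq_iff_eq_or_eq_neg.1 (hm m).2.2 with e | e
  · have hKK : K = K' := by
      have := (hm m).2.1
      rw [← e] at this
      exact smul_right_injective _ hym this
    subst hKK
    exact Or.inr (Or.inl ⟨funext fun k => smul_left_injective ℝ (K0 K hK) (hm k).2.1, rfl⟩)
  · have hKK : K = -K' := by
      have := (hm m).2.1
      rw [show y' m = -(y m) by linarith, neg_smul, ← smul_neg] at this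
      exact smul_right_injective _ hym this
    subst hKK
    refine Or.inr (Or.inr ⟨funext fun k => smul_left_injective ℝ (K0 K' hK') ?_, rfl⟩)
    have := (hm k).2.1
    simp only [Pi.neg_apply]
    rw [neg_smul, ← this, smul_neg, neg_neg]

theorem isOpen_τs_iff {s : Set (Fin n → Oct)} :
    IsOpen[τs n] s ↔
      ∀ I ∈ Sph, IsOpen {p : (Fin n → ℝ) × (Fin n → ℝ) | aff p.1 p.2 I ∈ s} := by
  rw [τs, isOpen_iSup_iff]
  exact ⟨fun h I hI => isOpen_coinduced.1 (h ⟨I, hI⟩), fun h I => isOpen_coinduced.2 (h I.1 I.2)⟩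

variable {Ω : Set (Fin n → Oct)} {D : Set ((Fin n → ℝ) × (Fin n → ℝ))}

/-- A conjugation-invariant open partition of the parameter domain of an axially symmetric
slice-connected set is trivial. -/
theorem eq_empty_or_eq_empty_of_partition (hconn : @IsPreconnected _ (τs n) Ω)
    (hcone : Ω ⊆ cone n)
    (hD : ∀ p : (Fin n → ℝ) × (Fin n → ℝ), ∀ I ∈ Sph, aff p.1 p.2 I ∈ Ω ↔ p ∈ D)
    {A B : Set ((Fin n → ℝ) × (Fin n → ℝ))} (hA : IsOpen A) (hB : IsOpen B)
    (hAc : ∀ p ∈ A, (p.1, -p.2) ∈ A) (hBc : ∀ p ∈ B, (p.1, -p.2) ∈ B)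
    (hAB : A ∪ B = D) (hdisj : Disjoint A B) : A = ∅ ∨ B = ∅ := by
  let lift (S : Set ((Fin n → ℝ) × (Fin n → ℝ))) : Set (Fin n → Oct) :=
    {q | ∃ p ∈ S, ∃ K ∈ Sph, q = aff p.1 p.2 K}
  have hlift (S : Set ((Fin n → ℝ) × (Fin n → ℝ))) (hSc : ∀ p ∈ S, (p.1, -p.2) ∈ S)
      (p : (Fin n → ℝ) × (Fin n → ℝ)) (K : Oct) (hK : K ∈ Sph) :
      aff p.1 p.2 K ∈ lift S ↔ p ∈ S := by
    refine ⟨?_, fun hp => ⟨p, hp, K, hK, rfl⟩⟩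
    rintro ⟨p', hp', K', hK', h⟩
    obtain ⟨h1, ⟨e, e'⟩ | ⟨e, -⟩ | ⟨e, -⟩⟩ := aff_eq_aff hK hK' h
    · rwa [show p = p' from Prod.ext h1 (e.trans e'.symm)]
    · rwa [show p = p' from Prod.ext h1 e]
    · rw [show p = (p'.1, -p'.2) from Prod.ext h1 e]
      exact hSc _ hp'
  have hopen (S : Set ((Fin n → ℝ) × (Fin n → ℝ))) (hS : IsOpen S)
      (hSc : ∀ p ∈ S, (p.1, -p.2) ∈ S) : IsOpen[τs n] (lift S) := by
    refine isOpen_τs_iff.2 fun K hK => ?_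
    convert hS using 1
    ext p
    exact hlift S hSc p K hK
  obtain ⟨K, hK, -⟩ := exists_mem_Sph_ne 0
  by_contra! hne
  obtain ⟨⟨a, ha⟩, ⟨b, hb⟩⟩ := hne
  obtain ⟨q, hq, hqA, hqB⟩ := hconn (lift A) (lift B) (hopen A hA hAc) (hopen B hB hBc)
    (fun q hq => by
      obtain ⟨L, hL, x, y, rfl⟩ := Set.mem_iUnion₂.1 (hcone hq)
      rcases hAB.symm ▸ (hD (x, y) L hL).1 hq with h | h
      · exact Or.inl ⟨(x, y), h, L, hL, rfl⟩
      · exact Or.inr ⟨(x, y), h, L, hL, rfl⟩)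
    ⟨aff a.1 a.2 K, (hD a K hK).2 (hAB ▸ Or.inl ha), a, ha, K, hK, rfl⟩
    ⟨aff b.1 b.2 K, (hD b K hK).2 (hAB ▸ Or.inr hb), b, hb, K, hK, rfl⟩
  obtain ⟨p, hp, L, hL, rfl⟩ := hqA
  exact Set.disjoint_left.1 hdisj hp ((hlift B hBc p L hL).1 hqB)

/-- A nonempty axially symmetric slice-connected slice-open set contains a real point. -/
theorem exists_real_mem (hconn : @IsPreconnected _ (τs n) Ω) (hcone : Ω ⊆ cone n)
    (hD : ∀ p : (Fin n → ℝ) × (Fin n → ℝ), ∀ I ∈ Sph, aff p.1 p.2 I ∈ Ω ↔ p ∈ D)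
    (hDo : IsOpen D) (hDne : D.Nonempty) : ∃ x, (x, 0) ∈ D := by
  by_contra! hcon
  have hne (p) (hp : p ∈ D) : p.2 ≠ 0 := fun h => hcon p.1 (by rwa [← h])
  obtain ⟨I, hI, -⟩ := exists_mem_Sph_ne 0
  obtain ⟨K, hK, hKI, hKI'⟩ := exists_mem_Sph_ne I
  have hDc (p : (Fin n → ℝ) × (Fin n → ℝ)) (hp : p ∈ D) : (p.1, -p.2) ∈ D := by
    rw [← hD _ I hI, aff_neg]
    exact (hD p _ (neg_mem_Sph hI)).2 hp
  let part (P : Oct → Prop) : Set (Fin n → Oct) :=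
    {q | ∃ p ∈ D, ∃ K ∈ Sph, P K ∧ q = aff p.1 p.2 K}
  have hpart (P : Oct → Prop) (hP : ∀ L, P (-L) ↔ P L) (p : (Fin n → ℝ) × (Fin n → ℝ)) (L : Oct)
      (hL : L ∈ Sph) : aff p.1 p.2 L ∈ part P ↔ p ∈ D ∧ P L := by
    refine ⟨?_, fun hp => ⟨p, hp.1, L, hL, hp.2, rfl⟩⟩
    rintro ⟨p', hp', K', hK', hPK, h⟩
    obtain ⟨h1, ⟨-, e⟩ | ⟨e, rfl⟩ | ⟨e, rfl⟩⟩ := aff_eq_aff hL hK' h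
    · exact (hne p' hp' e).elim
    · rw [show p = p' from Prod.ext h1 e]
      exact ⟨hp', hPK⟩
    · rw [show p = (p'.1, -p'.2) from Prod.ext h1 e]
      exact ⟨hDc _ hp', (hP K').2 hPK⟩
  have hopen (P : Oct → Prop) (hP : ∀ L, P (-L) ↔ P L) : IsOpen[τs n] (part P) := by
    refine isOpen_τs_iff.2 fun L hL => ?_
    simp only [hpart P hP _ L hL]
    exact hDo.inter isOpen_const
  have hP : ∀ L : Oct, (-L = I ∨ -L = -I) ↔ (L = I ∨ L = -I) := fun L => by
    rw [neg_inj, neg_eq_iff_eq_neg, or_comm]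
  have hQ : ∀ L : Oct, ¬(-L = I ∨ -L = -I) ↔ ¬(L = I ∨ L = -I) := fun L => not_congr (hP L)
  obtain ⟨p, hp⟩ := hDne
  obtain ⟨q, hq, hqA, hqB⟩ := hconn (part fun L => L = I ∨ L = -I)
    (part fun L => ¬(L = I ∨ L = -I)) (hopen _ hP) (hopen _ hQ)
    (fun q hq => by
      obtain ⟨L, hL, x, y, rfl⟩ := Set.mem_iUnion₂.1 (hcone hq)
      have hxy := (hD (x, y) L hL).1 hq
      by_cases h : L = I ∨ L = -I
      · exact Or.inl ⟨(x, y), hxy, L, hL, h, rfl⟩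
      · exact Or.inr ⟨(x, y), hxy, L, hL, h, rfl⟩)
    ⟨aff p.1 p.2 I, (hD p I hI).2 hp, p, hp, I, hI, Or.inl rfl, rfl⟩
    ⟨aff p.1 p.2 K, (hD p K hK).2 hp, p, hp, K, hK, by tauto, rfl⟩
  obtain ⟨p', hp', L, hL, hLP, rfl⟩ := hqA
  exact ((hpart _ hQ p' L hL).1 hqB).2 hLP

end Slices

section SeveralVariables

variable {n : ℕ} {F : Type*} [NormedAddCommGroup F] [NormedSpace ℝ F] [NormedSpace ℂ F]
  [IsScalarTower ℝ ℂ F]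

/-- A real-linear map on `ℝⁿ × ℝⁿ ≅ ℂⁿ` satisfying the Cauchy–Riemann equations is
complex-linear. -/
theorem map_rotate_eq_I_smul (L : (Fin n → ℝ) × (Fin n → ℝ) →L[ℝ] F)
    (hL : ∀ m, L (Pi.single m 1, 0) + Complex.I • L (0, Pi.single m 1) = 0)
    (v : (Fin n → ℝ) × (Fin n → ℝ)) : L (-v.2, v.1) = Complex.I • L v := by
  have hL' (m : Fin n) : Complex.I • L (Pi.single m 1, 0) = L (0, Pi.single m 1) := by
    rw [eq_neg_of_add_eq_zero_left (hL m), smul_neg, smul_smul, Complex.I_mul_I, neg_smul,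
      one_smul, neg_neg]
  have single_eq (m : Fin n) : (fun j => if m = j then (1 : ℝ) else 0) = Pi.single m 1 := by
    funext j
    simp [Pi.single_apply, eq_comm]
  have h1 (a : Fin n → ℝ) : L (0, a) = Complex.I • L (a, 0) := by
    have e1 : L (a, 0) = ∑ m, a m • L (Pi.single m 1, 0) := by
      have := LinearMap.pi_apply_eq_sum_univ
        (L.toLinearMap ∘ₗ LinearMap.inl ℝ (Fin n → ℝ) (Fin n → ℝ)) a
      simpa [single_eq] using this
    have e2 : L (0, a) = ∑ m, a m • L (0, Pi.single m 1) := by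
      have := LinearMap.pi_apply_eq_sum_univ
        (L.toLinearMap ∘ₗ LinearMap.inr ℝ (Fin n → ℝ) (Fin n → ℝ)) a
      simpa [single_eq] using this
    rw [e1, e2, Finset.smul_sum]
    exact Finset.sum_congr rfl fun m _ => by rw [smul_comm, hL']
  have e : (-v.2, v.1) = ((0, v.1) : (Fin n → ℝ) × (Fin n → ℝ)) - (v.2, 0) := by
    ext <;> simp
  have e' : v = ((v.1, 0) : (Fin n → ℝ) × (Fin n → ℝ)) + (0, v.2) := by
    ext <;> simp
  conv_rhs => rw [e']
  rw [e, map_sub, map_add, smul_add, h1 v.2, h1 v.1, smul_smul, Complex.I_mul_I, neg_smul,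
    one_smul, sub_eq_add_neg]

/-- The complex line through `p` in the direction `v`, in real coordinates. -/
def complexLine (p v : (Fin n → ℝ) × (Fin n → ℝ)) (z : ℂ) : (Fin n → ℝ) × (Fin n → ℝ) :=
  p + (z.re • v + z.im • (-v.2, v.1))

theorem hasFDerivAt_complexLine (p v : (Fin n → ℝ) × (Fin n → ℝ)) (z : ℂ) :
    HasFDerivAt (complexLine p v)
      (Complex.reCLM.smulRight v + Complex.imCLM.smulRight (-v.2, v.1)) z :=
  (Complex.reCLM.smulRight v + Complex.imCLM.smulRight (-v.2, v.1)).hasFDerivAt.const_add p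

variable [CompleteSpace F]

theorem eq_zero_on_complexLine {U : Set ((Fin n → ℝ) × (Fin n → ℝ))} (hU : IsOpen U)
    (hc : Convex ℝ U) {h : (Fin n → ℝ) × (Fin n → ℝ) → F} (hh : DifferentiableOn ℝ h U)
    (hCR : ∀ p ∈ U, ∀ m,
      fderiv ℝ h p (Pi.single m 1, 0) + Complex.I • fderiv ℝ h p (0, Pi.single m 1) = 0)
    {p v : (Fin n → ℝ) × (Fin n → ℝ)} (hp : p ∈ U)
    (hfreq : ∃ᶠ z in 𝓝[≠] (0 : ℂ), h (complexLine p v z) = 0) {z : ℂ}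
    (hz : complexLine p v z ∈ U) : h (complexLine p v z) = 0 := by
  have hcont : Continuous (complexLine p v) := continuous_iff_continuousAt.2 fun z =>
    (hasFDerivAt_complexLine p v z).continuousAt
  have hV : IsOpen (complexLine p v ⁻¹' U) := hU.preimage hcont
  have hVc : Convex ℝ (complexLine p v ⁻¹' U) := by
    have : complexLine p v ⁻¹' U =
        (Complex.reCLM.smulRight v + Complex.imCLM.smulRight (-v.2, v.1)).toLinearMap ⁻¹'
          ((fun w => p + w) ⁻¹' U) := rfl
    rw [this]
    exact (hc.translate_preimage_right p).linear_preimage _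
  have hd : DifferentiableOn ℂ (fun z => h (complexLine p v z)) (complexLine p v ⁻¹' U) := by
    intro w hw
    have hL := (hh.differentiableAt (hU.mem_nhds hw)).hasFDerivAt
    have hcomp := hL.comp w (hasFDerivAt_complexLine p v w)
    set L := fderiv ℝ h (complexLine p v w)
    refine (hasFDerivAt_of_restrictScalars ℝ (f := h ∘ complexLine p v)
      (f' := (1 : ℂ →L[ℂ] ℂ).smulRight (L v)) hcomp ?_).differentiableAt.differentiableWithinAt
    ext1 ζ
    have := map_rotate_eq_I_smul L (hCR _ hw) v
    change ζ • L v = L (ζ.re • v + ζ.im • (-v.2, v.1))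
    rw [map_add, map_smul, map_smul, this]
    conv_lhs => rw [← Complex.re_add_im ζ]
    have hr (r : ℝ) (u : F) : (r : ℂ) • u = r • u := algebraMap_smul ℂ r u
    rw [add_smul, mul_smul, hr, hr]
  have hana := hd.analyticOnNhd hV
  exact hana.eqOn_zero_of_preconnected_of_frequently_eq_zero hVc.isPreconnected
    (by simpa [complexLine] using hp) hfreq hz

theorem eqOn_zero_of_eventuallyEq {U : Set ((Fin n → ℝ) × (Fin n → ℝ))} (hU : IsOpen U)
    (hc : Convex ℝ U) {h : (Fin n → ℝ) × (Fin n → ℝ) → F} (hh : DifferentiableOn ℝ h U)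
    (hCR : ∀ p ∈ U, ∀ m,
      fderiv ℝ h p (Pi.single m 1, 0) + Complex.I • fderiv ℝ h p (0, Pi.single m 1) = 0)
    {p : (Fin n → ℝ) × (Fin n → ℝ)} (hp : p ∈ U) (hev : ∀ᶠ q in 𝓝 p, h q = 0) :
    ∀ q ∈ U, h q = 0 := by
  intro q hq
  have h1 : complexLine p (q - p) 1 = q := by simp [complexLine]
  rw [← h1]
  refine eq_zero_on_complexLine hU hc hh hCR hp ?_ (by rwa [h1])
  have hcont := (hasFDerivAt_complexLine p (q - p) 0).continuousAt
  have h0 : complexLine p (q - p) 0 = p := by simp [complexLine]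
  rw [ContinuousAt, h0] at hcont
  exact ((hcont.eventually hev).filter_mono nhdsWithin_le_nhds).frequently

theorem eq_zero_of_eq_zero_on_real {U : Set ((Fin n → ℝ) × (Fin n → ℝ))} (hU : IsOpen U)
    (hc : Convex ℝ U) {h : (Fin n → ℝ) × (Fin n → ℝ) → F} (hh : DifferentiableOn ℝ h U)
    (hCR : ∀ p ∈ U, ∀ m,
      fderiv ℝ h p (Pi.single m 1, 0) + Complex.I • fderiv ℝ h p (0, Pi.single m 1) = 0)
    (hreal : ∀ x, h (x, 0) = 0) {x y : Fin n → ℝ} (hx : (x, 0) ∈ U) (hxy : (x, y) ∈ U) :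
    h (x, y) = 0 := by
  have h1 : complexLine (x, 0) (y, 0) Complex.I = (x, y) := by simp [complexLine]
  rw [← h1]
  refine eq_zero_on_complexLine hU hc hh hCR hx ?_ (by rwa [h1])
  have hmap : Filter.Tendsto (fun t : ℝ => (t : ℂ)) (𝓝[≠] 0) (𝓝[≠] 0) := by
    refine tendsto_nhdsWithin_of_tendsto_nhds_of_eventually_within _ ?_ ?_
    · exact (Complex.continuous_ofReal.tendsto' 0 0 (by simp)).mono_left nhdsWithin_le_nhds
    · filter_upwards [self_mem_nhdsWithin] with t ht
      simpa using ht
  refine hmap.frequently (Filter.Eventually.frequently (Filter.Eventually.of_forall fun t => ?_))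
  simpa [complexLine] using hreal (x + t • y)

end SeveralVariables

section Holomorphy

variable {n : ℕ} {U V : Set ((Fin n → ℝ) × (Fin n → ℝ))} {I J : Oct}

theorem Holo.mono {g : (Fin n → ℝ) × (Fin n → ℝ) → Oct} (hg : Holo n I g U) (h : V ⊆ U) :
    Holo n I g V :=
  ⟨hg.1.mono h, fun p hp => hg.2 p (h hp)⟩

theorem Holo.eqOn_zero_of_eventuallyEq {g : (Fin n → ℝ) × (Fin n → ℝ) → Oct} (hI : I ∈ Sph)
    (hg : Holo n I g U) (hU : IsOpen U) (hc : Convex ℝ U) {p : (Fin n → ℝ) × (Fin n → ℝ)}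
    (hp : p ∈ U) (hev : ∀ᶠ q in 𝓝 p, g q = 0) : ∀ q ∈ U, g q = 0 := by
  let := complexNormedSpace hI
  have := isScalarTower_complex hI
  refine _root_.eqOn_zero_of_eventuallyEq hU hc (hg.1.differentiableOn one_ne_zero)
    (fun p hp m => ?_) hp hev
  rw [← hg.2 p hp m]
  congr 1
  change Complex.I.re • _ + Complex.I.im • (I * _) = _
  simp

theorem Holo.eq_zero_of_eq_zero_on_real {g : (Fin n → ℝ) × (Fin n → ℝ) → Oct} (hI : I ∈ Sph)
    (hg : Holo n I g U) (hU : IsOpen U) (hc : Convex ℝ U) (hreal : ∀ x, g (x, 0) = 0)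
    {x y : Fin n → ℝ} (hx : (x, 0) ∈ U) (hxy : (x, y) ∈ U) : g (x, y) = 0 := by
  let := complexNormedSpace hI
  have := isScalarTower_complex hI
  refine _root_.eq_zero_of_eq_zero_on_real hU hc (hg.1.differentiableOn one_ne_zero)
    (fun p hp m => ?_) hreal hx hxy
  rw [← hg.2 p hp m]
  congr 1
  change Complex.I.re • _ + Complex.I.im • (I * _) = _
  simp

theorem Holo.sub {g g' : (Fin n → ℝ) × (Fin n → ℝ) → Oct} (hU : IsOpen U)
    (hg : Holo n I g U) (hg' : Holo n I g' U) : Holo n I (g - g') U := by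
  refine ⟨hg.1.sub hg'.1, fun p hp m => ?_⟩
  have d := (hg.1.differentiableOn one_ne_zero).differentiableAt (hU.mem_nhds hp)
  have d' := (hg'.1.differentiableOn one_ne_zero).differentiableAt (hU.mem_nhds hp)
  rw [fderiv_sub d d', _root_.sub_apply, _root_.sub_apply, mul_sub']
  have e := hg.2 p hp m
  have e' := hg'.2 p hp m
  rw [sub_add_sub_comm, e, e', sub_zero]

/-- Two functions holomorphic with respect to `J` and `-J` combine into one holomorphic with
respect to `I`. -/
theorem Holo.combine {P Q : (Fin n → ℝ) × (Fin n → ℝ) → Oct} (hI : I ∈ Sph) (hJ : J ∈ Sph)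
    (hU : IsOpen U) (hP : Holo n J P U) (hQ : Holo n (-J) Q U) :
    Holo n I (fun p => ((1 : ℝ) / 2) • (P p + Q p) -
      ((1 : ℝ) / 2) • (I * (J * (P p - Q p)))) U := by
  refine ⟨?_, fun p hp m => ?_⟩
  · exact ((hP.1.add hQ.1).const_smul _).sub (((mulLeftL I).contDiff.comp_contDiffOn
      ((mulLeftL J).contDiff.comp_contDiffOn (hP.1.sub hQ.1))).const_smul _)
  have dP := ((hP.1.differentiableOn one_ne_zero).differentiableAt (hU.mem_nhds hp)).hasFDerivAt
  have dQ := ((hQ.1.differentiableOn one_ne_zero).differentiableAt (hU.mem_nhds hp)).hasFDerivAt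
  have d := ((dP.add dQ).const_smul ((1 : ℝ) / 2)).sub (((mulLeftL I).hasFDerivAt.comp p
      ((mulLeftL J).hasFDerivAt.comp p (dP.sub dQ))).const_smul ((1 : ℝ) / 2))
  have eP := eq_neg_of_add_eq_zero_left (hP.2 p hp m)
  have eQ := eq_neg_of_add_eq_zero_left (hQ.2 p hp m)
  have hd : fderiv ℝ (fun p => ((1 : ℝ) / 2) • (P p + Q p) -
      ((1 : ℝ) / 2) • (I * (J * (P p - Q p)))) p = _ := d.fderiv
  rw [hd]
  simp only [_root_.sub_apply, _root_.smul_apply,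
    _root_.add_apply, ContinuousLinearMap.comp_apply, mulLeftL_apply]
  rw [eP, eQ]
  simp only [neg_mul', mul_sub', mul_add', mul_neg', mul_smul', neg_neg,
    mul_mul_self_of_mem_Sph hI, mul_mul_self_of_mem_Sph hJ]
  module

end Holomorphy

/-- **Representation Formula.** For a weak slice regular
function on an axially symmetric slice-domain,
`f(x+yI) = ½(f(x+yJ) + f(x−yJ)) − ½ I (J (f(x+yJ) − f(x−yJ)))`. -/
theorem representation_formula (n : ℕ) (hn : 1 ≤ n)
    (Ω : Set (Fin n → Oct)) (hΩ : SliceDomain n Ω) (hax : AxSymm n Ω)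
    (f : (Fin n → Oct) → Oct) (hf : WSliceReg n Ω f) :
    ∀ (x y : Fin n → ℝ), ∀ I ∈ Sph, ∀ J ∈ Sph,
      aff x y I ∈ Ω → aff x y J ∈ Ω → aff x (-y) J ∈ Ω →
      f (aff x y I) =
        ((1 : ℝ) / 2) • (f (aff x y J) + f (aff x (-y) J)) -
          ((1 : ℝ) / 2) • (I * (J * (f (aff x y J) - f (aff x (-y) J)))) := by
  obtain ⟨⟨hcone, hopen⟩, hne, hconn⟩ := hΩ
  intro x y I hI J hJ _ hxJ _
  set D : Set ((Fin n → ℝ) × (Fin n → ℝ)) := {p | aff p.1 p.2 J ∈ Ω}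
  have hD : ∀ p : (Fin n → ℝ) × (Fin n → ℝ), ∀ K ∈ Sph, aff p.1 p.2 K ∈ Ω ↔ p ∈ D :=
    fun p K hK => ⟨hax _ _ K hK J hJ, hax _ _ J hJ K hK⟩
  have hDo : IsOpen D := isOpen_τs_iff.1 hopen J hJ
  have hDc (p : (Fin n → ℝ) × (Fin n → ℝ)) (hp : p ∈ D) : (p.1, -p.2) ∈ D := by
    rw [← hD _ J hJ, aff_neg]
    exact (hD p _ (neg_mem_Sph hJ)).2 hp
  have hf' (K : Oct) (hK : K ∈ Sph) : Holo n K (fun p => f (aff p.1 p.2 K)) D :=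
    (hf K hK).mono fun p hp => (hD p K hK).2 hp
  have hQ : Holo n (-J) (fun p => f (aff p.1 (-p.2) J)) D := by
    simpa only [aff_neg] using hf' (-J) (neg_mem_Sph hJ)
  set h : (Fin n → ℝ) × (Fin n → ℝ) → Oct := (fun p => f (aff p.1 p.2 I)) -
    fun p => ((1 : ℝ) / 2) • (f (aff p.1 p.2 J) + f (aff p.1 (-p.2) J)) -
      ((1 : ℝ) / 2) • (I * (J * (f (aff p.1 p.2 J) - f (aff p.1 (-p.2) J)))) with h_def
  have hh : Holo n I h D := (hf' I hI).sub hDo (Holo.combine hI hJ hDo (hf' J hJ) hQ)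
  have hball (p) (hp : p ∈ D) : ∃ r > 0, Metric.ball p r ⊆ D := Metric.isOpen_iff.1 hDo p hp
  set Z : Set ((Fin n → ℝ) × (Fin n → ℝ)) := {p | p ∈ D ∧ ∀ᶠ q in 𝓝 p, h q = 0}
  have hZo : IsOpen Z := hDo.inter isOpen_setOfPred_eventually_nhds
  have hZo' : IsOpen (D \ Z) := by
    refine Metric.isOpen_iff.2 fun p hp => ?_
    obtain ⟨r, hr, hrD⟩ := hball p hp.1
    refine ⟨r, hr, fun q hq => ⟨hrD hq, fun hqZ => hp.2 ⟨hp.1, ?_⟩⟩⟩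
    have := (hh.mono hrD).eqOn_zero_of_eventuallyEq hI Metric.isOpen_ball (convex_ball p r) hq hqZ.2
    filter_upwards [Metric.ball_mem_nhds p hr] with q' hq' using this q' hq'
  set conj : (Fin n → ℝ) × (Fin n → ℝ) → (Fin n → ℝ) × (Fin n → ℝ) := fun p => (p.1, -p.2)
    with hconj
  have hcc : Continuous conj := by fun_prop
  have hinv (p) : conj (conj p) = p := by simp [hconj]
  obtain ⟨q, hq⟩ := hne
  obtain ⟨L, hL, a, b, rfl⟩ := Set.mem_iUnion₂.1 (hcone hq)
  obtain ⟨x₀, hx₀⟩ := exists_real_mem hconn hcone hD hDo ⟨(a, b), (hD (a, b) L hL).1 hq⟩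
  have hx₀Z : (x₀, 0) ∈ Z := by
    obtain ⟨r, hr, hrD⟩ := hball _ hx₀
    refine ⟨hx₀, ?_⟩
    filter_upwards [Metric.ball_mem_nhds (x₀, (0 : Fin n → ℝ)) hr] with q hq
    refine (hh.mono hrD).eq_zero_of_eq_zero_on_real (x := q.1) (y := q.2) hI Metric.isOpen_ball
      (convex_ball _ r) (fun x => ?_) ?_ hq
    · simp only [h_def, Pi.sub_apply, neg_zero, aff_zero x I J, sub_self]
      rw [← mulLeftL_apply J, map_zero, ← mulLeftL_apply I, map_zero]
      module
    · rw [Metric.mem_ball, Prod.dist_eq] at hq ⊢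
      simpa [hr] using lt_of_le_of_lt (le_max_left _ _) hq
  have key := eq_empty_or_eq_empty_of_partition hconn hcone hD
    (A := Z ∩ conj ⁻¹' Z) (B := (D \ Z) ∪ conj ⁻¹' (D \ Z))
    (hZo.inter (hZo.preimage hcc)) (hZo'.union (hZo'.preimage hcc))
    (fun p hp => ⟨hp.2, show conj (conj p) ∈ Z by rw [hinv]; exact hp.1⟩)
    (fun p hp => hp.symm.imp id fun h => show conj (conj p) ∈ D \ Z by rw [hinv]; exact h)
    (by
      ext p
      have h1 : p ∈ Z → p ∈ D := fun h => h.1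
      have h2 : p ∈ D → conj p ∈ D := hDc p
      have h3 : conj p ∈ D → p ∈ D := fun h => hinv p ▸ hDc _ h
      simp only [Set.mem_union, Set.mem_inter_iff, Set.mem_preimage, Set.mem_sdiff]
      tauto)
    (Set.disjoint_left.2 fun p hp hp' => hp'.elim (fun h => h.2 hp.1) fun h => h.2 hp.2)
  rcases key with h0 | h0
  · have : (x₀, (0 : Fin n → ℝ)) ∈ Z ∩ conj ⁻¹' Z :=
      ⟨hx₀Z, show conj (x₀, 0) ∈ Z by simpa [hconj] using hx₀Z⟩
    rw [h0] at this
    exact this.elim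
  · have hxyZ : (x, y) ∈ Z := by
      by_contra hcon
      have : (x, y) ∈ (D \ Z) ∪ conj ⁻¹' (D \ Z) := Or.inl ⟨hxJ, hcon⟩
      rw [h0] at this
      exact this.elim
    exact sub_eq_zero.1 hxyZ.2.self_of_nhds

end
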